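/- arXiv:2109.06576 — 3 statements merged into one kernel-verified Lean document; each statement's English description precedes it below -/
import Mathlib

section
/- Theorem 3, uniqueness part: the all-zero profile is the only Nash equilibrium of the FMD-RA game. Assume f > 0, L ≥ 0, and in(u) < M for every user u. If a profile p̂ : Fin U → [0,1] is a Nash equilibrium, i.e., for every player u and every q ∈ [0,1] the utility φ_u(q, p̂_{−u}) of unilaterally deviating to q is at most φ_u(p̂), then p̂(u) = 0 for every u. -/
/-- The utility of player `u` in the FMD-RA game:
`φ_u(p) = -L·(1 - (1 - α_u)^{in(u)}) - f·(in(u) + p(u)·(M - in(u)))`,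
where `α_u = ∏_{v ≠ u} (1 - p(v))`. -/
noncomputable def fmdUtility (U : ℕ) (f L : ℝ) (M : ℕ) (inn : Fin U → ℕ)
    (p : Fin U → ℝ) (u : Fin U) : ℝ :=
  -L * (1 - (1 - ∏ v ∈ Finset.univ.erase u, (1 - p v)) ^ inn u) -
    f * ((inn u : ℝ) + p u * ((M : ℝ) - (inn u : ℝ)))

/-- Theorem 3, uniqueness part: if `f > 0` and `in(u) < M` for all users, then every Nash
equilibrium of the FMD-RA game is the all-zero (no-protection) profile. -/
theorem fmd_nash_unique (U : ℕ) (f L : ℝ) (hf : 0 < f) (hL : 0 ≤ L) (M : ℕ)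
    (inn : Fin U → ℕ) (hin : ∀ u, inn u < M)
    (phat : Fin U → ℝ) (hphat : ∀ u, phat u ∈ Set.Icc (0 : ℝ) 1)
    (hNE : ∀ u, ∀ q ∈ Set.Icc (0 : ℝ) 1,
      fmdUtility U f L M inn (Function.update phat u q) u ≤ fmdUtility U f L M inn phat u) :
    ∀ u, phat u = 0 := by
  intro u
  have hprod (q : ℝ) : ∏ v ∈ Finset.univ.erase u, (1 - Function.update phat u q v) =
      ∏ v ∈ Finset.univ.erase u, (1 - phat v) :=
    Finset.prod_congr rfl fun v hv => by
      rw [Function.update_of_ne (Finset.ne_of_mem_erase hv)]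
  have hdev := hNE u 0 (by simp)
  simp only [fmdUtility, hprod, Function.update_self] at hdev
  have hcost : 0 < f * ((M : ℝ) - inn u) :=
    mul_pos hf (sub_pos.mpr (by exact_mod_cast hin u))
  have hle : phat u * (f * ((M : ℝ) - inn u)) ≤ 0 := by linarith
  exact le_antisymm (nonpos_of_mul_nonpos_left hle hcost) (hphat u).1
end

section
/- Theorem 4: the social optimum of the FMD-RA game under a common false-positive rate is not the no-protection equilibrium. Assume U ≥ 3 users, f > 0, L > 0, and for every user u: 1 ≤ in(u) < M and f·(M − in(u)) < L. Define the social welfare W(p) = Σ_{u=1}^{U} φ_u(p) for p ∈ [0,1], where φ_u is the uniform-rate utility. Then every maximizer p* of W on [0,1] satisfies 0 < p* < 1; in particular the social optimum differs from the unique Nash equilibrium p = 0 and attains strictly higher social welfare. -/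
/-- The uniform-rate utility of a user with `in(u)` incoming messages when all `U` users use
the common false-positive rate `p`:
`φ_u(p) = -L·(1 - (1 - (1-p)^{U-1})^{in(u)}) - f·(in(u) + p·(M - in(u)))`. -/
noncomputable def fmdUniformUtility (U : ℕ) (f L : ℝ) (M : ℕ) (innu : ℕ) (p : ℝ) : ℝ :=
  -L * (1 - (1 - (1 - p) ^ (U - 1)) ^ innu) -
    f * ((innu : ℝ) + p * ((M : ℝ) - (innu : ℝ)))

/-- Full cover traffic beats no cover traffic when the download cost is below the privacy loss. -/
theorem fmdUniformUtility_zero_lt_one {U : ℕ} (hU : 2 ≤ U) {f L : ℝ} {M k : ℕ} (hk : 1 ≤ k)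
    (h : f * ((M : ℝ) - k) < L) :
    fmdUniformUtility U f L M k 0 < fmdUniformUtility U f L M k 1 := by
  have hk0 : k ≠ 0 := by omega
  have hU0 : U - 1 ≠ 0 := by omega
  simp only [fmdUniformUtility, sub_zero, one_pow, sub_self, zero_pow hk0, zero_pow hU0]
  linarith

/-- Lowering the rate slightly below `1` is profitable: the privacy loss is of order `ε ^ 2`,
the saved download cost is linear in `ε`. -/
theorem fmdUniformUtility_one_lt_one_sub {U : ℕ} (hU : 3 ≤ U) {f L : ℝ} (hf : 0 < f)
    (hL : 0 ≤ L) {M k : ℕ} (hk : k < M) {ε : ℝ} (hε : 0 < ε) (hε1 : ε ≤ 1)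
    (h : L * M * ε < f) :
    fmdUniformUtility U f L M k 1 < fmdUniformUtility U f L M k (1 - ε) := by
  have hU0 : U - 1 ≠ 0 := by omega
  have hpow : ε ^ (U - 1) ≤ ε ^ 2 := pow_le_pow_of_le_one hε.le hε1 (by omega)
  have hpow1 : ε ^ (U - 1) ≤ 1 := pow_le_one₀ hε.le hε1
  have bernoulli : 1 + (k : ℝ) * (-ε ^ (U - 1)) ≤ (1 + -ε ^ (U - 1)) ^ k :=
    one_add_mul_le_pow (by linarith) k
  have hkM : (k : ℝ) + 1 ≤ M := by exact_mod_cast hk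
  have hkε : (k : ℝ) * ε ^ (U - 1) ≤ M * ε ^ 2 := by
    gcongr
  have hloss : L * (1 - (1 - ε ^ (U - 1)) ^ k) ≤ L * (M * ε ^ 2) := by
    rw [← sub_eq_add_neg] at bernoulli
    exact mul_le_mul_of_nonneg_left (by linarith) hL
  have hsmall : L * M * ε * ε < f * ε := mul_lt_mul_of_pos_right h hε
  have hgain : f * ε * 1 ≤ f * ε * ((M : ℝ) - k) :=
    mul_le_mul_of_nonneg_left (by linarith) (by positivity)
  simp only [fmdUniformUtility, sub_self, zero_pow hU0, sub_zero, one_pow, sub_sub_cancel]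
  linarith

/-- Theorem 4: under the stated conditions, every maximizer of the social welfare
`W(p) = Σ_u φ_u(p)` over the common rate `p ∈ [0,1]` is interior (`0 < p* < 1`); in
particular the social optimum differs from the unique Nash equilibrium `p = 0` and attains
strictly higher social welfare. -/
theorem fmd_social_optimum_interior (U : ℕ) (hU : 3 ≤ U) (f L : ℝ) (hf : 0 < f)
    (hL : 0 < L) (M : ℕ) (inn : Fin U → ℕ)
    (hin : ∀ u, 1 ≤ inn u ∧ inn u < M)
    (hcond : ∀ u, f * ((M : ℝ) - (inn u : ℝ)) < L)
    (W : ℝ → ℝ) (hW : W = fun p => ∑ u : Fin U, fmdUniformUtility U f L M (inn u) p)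
    (pstar : ℝ) (hps : pstar ∈ Set.Icc (0 : ℝ) 1)
    (hmax : ∀ q ∈ Set.Icc (0 : ℝ) 1, W q ≤ W pstar) :
    0 < pstar ∧ pstar < 1 ∧ W 0 < W pstar := by
  have hne : (Finset.univ : Finset (Fin U)).Nonempty := ⟨⟨0, by omega⟩, Finset.mem_univ _⟩
  have h01 : W 0 < W 1 := by
    subst hW
    exact Finset.sum_lt_sum_of_nonempty hne fun u _ =>
      fmdUniformUtility_zero_lt_one (by omega) (hin u).1 (hcond u)
  have hLM : 0 ≤ L * M := by positivity
  have hden : 0 < f + L * M := by positivity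
  have hε : 0 < f / (f + L * M) := div_pos hf hden
  have hε1 : f / (f + L * M) ≤ 1 := (div_le_one hden).2 (by linarith)
  have hsmall : L * M * (f / (f + L * M)) < f := by
    rw [← mul_div_assoc, div_lt_iff₀ hden]
    nlinarith
  have h1ε : W 1 < W (1 - f / (f + L * M)) := by
    subst hW
    exact Finset.sum_lt_sum_of_nonempty hne fun u _ =>
      fmdUniformUtility_one_lt_one_sub hU hf hL.le (hin u).2 hε hε1 hsmall
  have h1 : W 1 < W pstar := h1ε.trans_le (hmax _ ⟨by linarith, by linarith⟩)
  have h0 : W 0 < W pstar := h01.trans h1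
  refine ⟨hps.1.lt_of_ne ?_, hps.2.lt_of_ne ?_, h0⟩
  · rintro rfl
    exact h0.false
  · rintro rfl
    exact h1.false
end

section
/- Theorem 5 (FMD-RA is a potential game): define Ψ(p(1),…,p(U)) = −f·Σ_{u=1}^{U} p(u)·(M − in(u)). Then for every player u, every profile p of false-positive rates in [0,1], and every pair of own-actions q, q′ ∈ [0,1]: φ_u(q, p_{−u}) − φ_u(q′, p_{−u}) = Ψ(q, p_{−u}) − Ψ(q′, p_{−u}), where (q, p_{−u}) denotes the profile p with player u's rate replaced by q. -/
/-- Theorem 5 (FMD-RA is a potential game): with potential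
`Ψ(p) = -f·Σ_u p(u)·(M - in(u))`, every player's utility change under a unilateral
deviation equals the corresponding change of `Ψ`. -/
theorem fmd_potential_game (U : ℕ) (f L : ℝ) (M : ℕ) (inn : Fin U → ℕ)
    (Ψ : (Fin U → ℝ) → ℝ)
    (hΨ : Ψ = fun p => -f * ∑ u : Fin U, p u * ((M : ℝ) - (inn u : ℝ)))
    (u : Fin U) (p : Fin U → ℝ) (hp : ∀ v, p v ∈ Set.Icc (0 : ℝ) 1)
    (q q' : ℝ) (hq : q ∈ Set.Icc (0 : ℝ) 1) (hq' : q' ∈ Set.Icc (0 : ℝ) 1) :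
    fmdUtility U f L M inn (Function.update p u q) u -
        fmdUtility U f L M inn (Function.update p u q') u =
      Ψ (Function.update p u q) - Ψ (Function.update p u q') := by
  have h_prod (x : ℝ) : ∏ v ∈ Finset.univ.erase u, (1 - Function.update p u x v) =
      ∏ v ∈ Finset.univ.erase u, (1 - p v) :=
    Finset.prod_congr rfl fun v hv => by
      rw [Function.update_of_ne (Finset.ne_of_mem_erase hv)]
  have h_sum (x : ℝ) : ∑ v, Function.update p u x v * ((M : ℝ) - (inn v : ℝ)) =
      x * ((M : ℝ) - (inn u : ℝ)) +
        ∑ v ∈ Finset.univ.erase u, p v * ((M : ℝ) - (inn v : ℝ)) := by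
    rw [← Finset.add_sum_erase _ _ (Finset.mem_univ u), Function.update_self]
    congr 1
    exact Finset.sum_congr rfl fun v hv => by
      rw [Function.update_of_ne (Finset.ne_of_mem_erase hv)]
  simp only [hΨ, fmdUtility, h_prod, h_sum, Function.update_self]
  ring
end
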